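/- arXiv:1906.04096 — 3 statements merged into one kernel-verified Lean document; each statement's English description precedes it below -/
import Mathlib

section
/- Let m ≥ 1 be an integer, δ > 0, and let Z : ℕ → ℝ be a nonnegative sequence. Suppose there exist constants α > β > 0 and γ > 0 such that 1 − αδ > 0 and, for all k ∈ ℕ and all l ∈ {0,1,…,m−1}, Z_{km+l+1} ≤ (1 − αδ) Z_{km+l} + βδ Z_{km} + γδ. Then for all k ∈ ℕ and l ∈ {0,1,…,m−1}, Z_{km+l+1} ≤ (β/α + (1 − β/α) e^{−α(l+1)δ}) Z_{km} + γ/α. -/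
/-- A discrete Gronwall inequality with memory of the initial value: the affine recursion
`u (j + 1) ≤ (1 - αδ) u j + βδ u 0 + γδ` on `j < m` decays exponentially to its fixed point. -/
theorem le_exp_mul_add_of_affine_recursion {m : ℕ} {u : ℕ → ℝ} {α β γ δ : ℝ} (hu : 0 ≤ u 0)
    (hα : 0 < α) (hβα : β ≤ α) (hγ : 0 ≤ γ) (hαδ : 0 ≤ 1 - α * δ)
    (hrec : ∀ j < m, u (j + 1) ≤ (1 - α * δ) * u j + β * δ * u 0 + γ * δ) :
    ∀ j ≤ m, u j ≤ (β / α + (1 - β / α) * Real.exp (-α * (j : ℝ) * δ)) * u 0 + γ / α := by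
  intro j
  induction j with
  | zero =>
    intro _
    have : 0 ≤ γ / α := by positivity
    simpa using this
  | succ j ih =>
    intro hj
    have hexp : Real.exp (-α * ((j + 1 : ℕ) : ℝ) * δ)
        = Real.exp (-(α * δ)) * Real.exp (-α * (j : ℝ) * δ) := by
      rw [← Real.exp_add]
      push_cast
      ring_nf
    have hb : 0 ≤ 1 - β / α := sub_nonneg.2 ((div_le_one hα).2 hβα)
    have hq : 1 - α * δ ≤ Real.exp (-(α * δ)) := Real.one_sub_le_exp_neg _
    rw [hexp]
    set E := Real.exp (-α * (j : ℝ) * δ)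
    have hE0 : 0 ≤ E := (Real.exp_pos _).le
    calc u (j + 1) ≤ (1 - α * δ) * u j + β * δ * u 0 + γ * δ := hrec j hj
      _ ≤ (1 - α * δ) * ((β / α + (1 - β / α) * E) * u 0 + γ / α) + β * δ * u 0 + γ * δ := by
        gcongr
        exact ih (Nat.le_of_succ_le hj)
      _ = (β / α + (1 - β / α) * ((1 - α * δ) * E)) * u 0 + γ / α := by
        field_simp
        ring
      _ ≤ (β / α + (1 - β / α) * (Real.exp (-(α * δ)) * E)) * u 0 + γ / α := by
        gcongr


/-- Discrete recursion lemma (Lemma 3.4): if a nonnegative sequence satisfies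
`Z_{km+l+1} ≤ (1-αδ) Z_{km+l} + βδ Z_{km} + γδ` for `l < m`, then
`Z_{km+l+1} ≤ (β/α + (1-β/α) e^{-α(l+1)δ}) Z_{km} + γ/α`. -/
theorem stmt4 (m : ℕ) (hm : 1 ≤ m) (δ : ℝ) (hδ : 0 < δ)
    (Z : ℕ → ℝ) (hZ : ∀ n, 0 ≤ Z n)
    (α β γ : ℝ) (hβ : 0 < β) (hβα : β < α) (hγ : 0 < γ)
    (hαδ : 1 - α * δ > 0)
    (hrec : ∀ k l : ℕ, l < m →
      Z (k * m + l + 1) ≤ (1 - α * δ) * Z (k * m + l) + β * δ * Z (k * m) + γ * δ) :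
    ∀ k l : ℕ, l < m →
      Z (k * m + l + 1) ≤
        (β / α + (1 - β / α) * Real.exp (-α * ((l : ℝ) + 1) * δ)) * Z (k * m) + γ / α := by
  intro k l hl
  have h := le_exp_mul_add_of_affine_recursion (u := fun j => Z (k * m + j)) (hZ _)
    (hβ.trans hβα) hβα.le hγ.le hαδ.le (hrec k) (l + 1) hl
  simpa [add_assoc] using h
end

section
/- Let m ≥ 1 be an integer, δ = 1/m, and let Z : ℕ → ℝ be a nonnegative sequence. Suppose there exist constants α > β > 0 and γ > 0 with αδ < 1 such that, for all k ∈ ℕ and all l ∈ {0,1,…,m−1}, Z_{km+l+1} ≤ (1 − αδ) Z_{km+l} + βδ Z_{km} + γδ. Set r = β/α + (1 − β/α) e^{−α}, so 0 < r < 1. Then for all k ∈ ℕ and l ∈ {0,1,…,m−1}, Z_{km+l+1} ≤ (1/r) e^{(km+l+1)δ log r} Z_0 + (γ/α)·(2 − r)/(1 − r). In particular the whole sequence is bounded by (1/r) Z_0 + (γ/α)(2 − r)/(1 − r). -/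
/-- A sequence which at each of its first `m` steps is bounded by a convex combination of its
previous term and a constant satisfies the corresponding geometric bound. -/
theorem le_geometric_of_convex_step {a : ℕ → ℝ} {q c : ℝ} {m : ℕ} (hq : 0 ≤ q)
    (h : ∀ l < m, a (l + 1) ≤ q * a l + (1 - q) * c) {j : ℕ} (hj : j ≤ m) :
    a j ≤ q ^ j * a 0 + (1 - q ^ j) * c := by
  induction j with
  | zero => simp
  | succ j ih =>
    calc a (j + 1) ≤ q * a j + (1 - q) * c := h j hj
      _ ≤ q * (q ^ j * a 0 + (1 - q ^ j) * c) + (1 - q) * c := by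
        gcongr
        exact ih (by omega)
      _ = q ^ (j + 1) * a 0 + (1 - q ^ (j + 1)) * c := by ring

/-- Two-level discrete estimate (deterministic core of Lemma 3.5 / Corollary 3.6):
with `δ = 1/m` and `r = β/α + (1-β/α) e^{-α}` (so `0 < r < 1`), the recursion
`Z_{km+l+1} ≤ (1-αδ) Z_{km+l} + βδ Z_{km} + γδ` yields
`Z_{km+l+1} ≤ (1/r) e^{(km+l+1)δ log r} Z_0 + (γ/α)(2-r)/(1-r)`, and in particular
the whole sequence is bounded by `(1/r) Z_0 + (γ/α)(2-r)/(1-r)`. -/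
theorem stmt7 (m : ℕ) (hm : 1 ≤ m) (δ : ℝ) (hδ : δ = 1 / (m : ℝ))
    (Z : ℕ → ℝ) (hZ : ∀ n, 0 ≤ Z n)
    (α β γ : ℝ) (hβ : 0 < β) (hβα : β < α) (hγ : 0 < γ) (hαδ : α * δ < 1)
    (hrec : ∀ k l : ℕ, l < m →
      Z (k * m + l + 1) ≤ (1 - α * δ) * Z (k * m + l) + β * δ * Z (k * m) + γ * δ)
    (r : ℝ) (hr : r = β / α + (1 - β / α) * Real.exp (-α)) :
    (0 < r ∧ r < 1) ∧
    (∀ k l : ℕ, l < m →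
      Z (k * m + l + 1) ≤
        (1 / r) * Real.exp (((k * m + l + 1 : ℕ) : ℝ) * δ * Real.log r) * Z 0 +
          (γ / α) * (2 - r) / (1 - r)) ∧
    (∀ n : ℕ, Z n ≤ (1 / r) * Z 0 + (γ / α) * (2 - r) / (1 - r)) := by
  have hα : 0 < α := hβ.trans hβα
  have hm0 : (0 : ℝ) < m := by exact_mod_cast hm
  have hδ0 : 0 < δ := by rw [hδ]; positivity
  have hmδ : (m : ℝ) * δ = 1 := by rw [hδ]; field_simp
  have hs0 : 0 < β / α := by positivity
  have hs1 : β / α < 1 := (div_lt_one hα).2 hβα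
  have hE0 : 0 < Real.exp (-α) := Real.exp_pos _
  have hE1 : Real.exp (-α) < 1 := Real.exp_lt_one_iff.2 (by linarith)
  have hr0 : 0 < r := by rw [hr]; nlinarith
  have hr1 : r < 1 := by rw [hr]; nlinarith
  have hlog : Real.log r < 0 := Real.log_neg hr0 hr1
  have hq0 : 0 ≤ 1 - α * δ := by linarith
  have hq1 : 1 - α * δ ≤ 1 := by nlinarith
  have hγα : 0 < γ / α := by positivity
  have hblock (k j : ℕ) (hj : j ≤ m) : Z (k * m + j) ≤
      (1 - α * δ) ^ j * Z (k * m) +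
        (1 - (1 - α * δ) ^ j) * (β / α * Z (k * m) + γ / α) := by
    refine le_geometric_of_convex_step (a := fun j => Z (k * m + j)) hq0 (fun l hl => ?_) hj
    refine (hrec k l hl).trans_eq ?_
    field_simp
    ring
  have hqm : (1 - α * δ) ^ m ≤ Real.exp (-α) := by
    calc (1 - α * δ) ^ m ≤ Real.exp (-(α * δ)) ^ m :=
          pow_le_pow_left₀ hq0 (Real.one_sub_le_exp_neg _) m
      _ = Real.exp (-α) := by
        rw [← Real.exp_nat_mul]
        congr 1
        linear_combination (-α) * hmδ
  have hstep (k : ℕ) : Z ((k + 1) * m) ≤ r * Z (k * m) + (1 - r) * (γ / α / (1 - r)) := by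
    have h := hblock k m le_rfl
    have hcoef : (1 - β / α) * (1 - α * δ) ^ m * Z (k * m) ≤
        (1 - β / α) * Real.exp (-α) * Z (k * m) := by
      gcongr
      exact hZ _
    have hconst : 0 ≤ (1 - α * δ) ^ m * (γ / α) := by positivity
    rw [mul_div_cancel₀ _ (by linarith : (1 - r) ≠ 0), add_one_mul, hr]
    linarith
  have hgrid (k : ℕ) : Z (k * m) ≤ r ^ k * Z 0 + γ / α / (1 - r) := by
    have h := le_geometric_of_convex_step (a := fun k => Z (k * m)) hr0.le
      (fun l (_ : l < k) => hstep l) le_rfl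
    simp only [zero_mul] at h
    have hconst : 0 ≤ r ^ k * (γ / α / (1 - r)) :=
      mul_nonneg (by positivity) (div_nonneg hγα.le (by linarith))
    linarith
  have hinner (k j : ℕ) (hj : j ≤ m) : Z (k * m + j) ≤ Z (k * m) + γ / α := by
    have h := hblock k j hj
    have hp0 : 0 ≤ (1 - α * δ) ^ j := by positivity
    have hp1 : (1 - α * δ) ^ j ≤ 1 := pow_le_one₀ hq0 hq1
    have hcoef : 0 ≤ (1 - (1 - α * δ) ^ j) * (1 - β / α) * Z (k * m) :=
      mul_nonneg (mul_nonneg (by linarith) (by linarith)) (hZ _)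
    have hconst : 0 ≤ (1 - α * δ) ^ j * (γ / α) := by positivity
    linarith
  have hpow (k l : ℕ) (hl : l < m) :
      r ^ k ≤ (1 / r) * Real.exp (((k * m + l + 1 : ℕ) : ℝ) * δ * Real.log r) := by
    have hl' : ((l : ℝ) + 1) * δ ≤ 1 := by
      refine (mul_le_mul_of_nonneg_right ?_ hδ0.le).trans_eq hmδ
      exact_mod_cast hl
    have hexp : (k : ℝ) * Real.log r + Real.log r ≤
        ((k * m + l + 1 : ℕ) : ℝ) * δ * Real.log r := by
      have h : ((k * m + l + 1 : ℕ) : ℝ) * δ = k + (l + 1) * δ := by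
        push_cast
        linear_combination (k : ℝ) * hmδ
      rw [h]
      nlinarith
    rw [one_div_mul_eq_div, le_div_iff₀ hr0]
    calc r ^ k * r = Real.exp (k * Real.log r + Real.log r) := by
          rw [Real.exp_add, Real.exp_nat_mul, Real.exp_log hr0]
      _ ≤ _ := Real.exp_le_exp.2 hexp
  have hconst : γ / α / (1 - r) + γ / α = (γ / α) * (2 - r) / (1 - r) := by
    have : (1 - r) ≠ 0 := by linarith
    field_simp
    ring
  have hdecay (k l : ℕ) (hl : l < m) : Z (k * m + l + 1) ≤
      (1 / r) * Real.exp (((k * m + l + 1 : ℕ) : ℝ) * δ * Real.log r) * Z 0 +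
        (γ / α) * (2 - r) / (1 - r) := by
    have h := hinner k (l + 1) hl
    rw [← add_assoc] at h
    have hZ0 := mul_le_mul_of_nonneg_right (hpow k l hl) (hZ 0)
    linarith [hgrid k]
  refine ⟨⟨hr0, hr1⟩, hdecay, fun n => ?_⟩
  obtain _ | n := n
  · have hC : 0 ≤ (γ / α) * (2 - r) / (1 - r) :=
      div_nonneg (mul_nonneg hγα.le (by linarith)) (by linarith)
    have h1 : Z 0 ≤ (1 / r) * Z 0 :=
      le_mul_of_one_le_left (hZ 0) (one_le_one_div hr0 hr1.le)
    linarith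
  · have h := hdecay (n / m) (n % m) (Nat.mod_lt _ hm)
    rw [Nat.div_add_mod'] at h
    refine h.trans ?_
    gcongr
    · exact hZ 0
    · refine mul_le_of_le_one_right (by positivity) (Real.exp_le_one_iff.2 ?_)
      exact mul_nonpos_of_nonneg_of_nonpos (by positivity) hlog.le
end

section
/- Let m ≥ 1 be an integer, δ = 1/m, and let Z : ℕ → ℝ be a nonnegative sequence. Suppose there exist constants α > β > 0 with αδ < 1 such that, for all k ∈ ℕ and all l ∈ {0,1,…,m−1}, Z_{km+l+1} ≤ (1 − αδ) Z_{km+l} + βδ Z_{km}. Set r = β/α + (1 − β/α) e^{−α}, so 0 < r < 1. Then for all k ∈ ℕ and l ∈ {0,1,…,m−1}, Z_{km+l+1} ≤ (1/r) e^{(km+l+1)δ log r} Z_0; in particular Z_{km} ≤ (1/r) e^{k log r} Z_0 decays exponentially in k. -/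
/-- An affine recursion on a block of length `m`, with the block's initial value as forcing term,
is bounded by the corresponding convex combination of `1` and `q ^ j`. -/
theorem le_convex_combination_pow_of_affine_rec {m : ℕ} {q c : ℝ} {a : ℕ → ℝ} (hq : 0 ≤ q)
    (hrec : ∀ l < m, a (l + 1) ≤ q * a l + c * (1 - q) * a 0) {j : ℕ} (hj : j ≤ m) :
    a j ≤ (c + (1 - c) * q ^ j) * a 0 := by
  induction j with
  | zero => simp
  | succ j ih =>
    calc a (j + 1) ≤ q * a j + c * (1 - q) * a 0 := hrec j hj
      _ ≤ q * ((c + (1 - c) * q ^ j) * a 0) + c * (1 - q) * a 0 := by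
        gcongr
        exact ih (by omega)
      _ = (c + (1 - c) * q ^ (j + 1)) * a 0 := by ring

/-- Two-level discrete contraction estimate (deterministic core of Lemma 3.7):
with `δ = 1/m` and `r = β/α + (1-β/α) e^{-α}` (so `0 < r < 1`), the recursion
`Z_{km+l+1} ≤ (1-αδ) Z_{km+l} + βδ Z_{km}` yields
`Z_{km+l+1} ≤ (1/r) e^{(km+l+1)δ log r} Z_0`; in particular
`Z_{km} ≤ (1/r) e^{k log r} Z_0` decays exponentially in `k`. -/
theorem stmt8 (m : ℕ) (hm : 1 ≤ m) (δ : ℝ) (hδ : δ = 1 / (m : ℝ))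
    (Z : ℕ → ℝ) (hZ : ∀ n, 0 ≤ Z n)
    (α β : ℝ) (hβ : 0 < β) (hβα : β < α) (hαδ : α * δ < 1)
    (hrec : ∀ k l : ℕ, l < m →
      Z (k * m + l + 1) ≤ (1 - α * δ) * Z (k * m + l) + β * δ * Z (k * m))
    (r : ℝ) (hr : r = β / α + (1 - β / α) * Real.exp (-α)) :
    (0 < r ∧ r < 1) ∧
    (∀ k l : ℕ, l < m →
      Z (k * m + l + 1) ≤
        (1 / r) * Real.exp (((k * m + l + 1 : ℕ) : ℝ) * δ * Real.log r) * Z 0) ∧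
    (∀ k : ℕ, Z (k * m) ≤ (1 / r) * Real.exp ((k : ℝ) * Real.log r) * Z 0) := by
  have hα : 0 < α := hβ.trans hβα
  have hm0 : (0 : ℝ) < m := by exact_mod_cast hm
  have hδm : δ * m = 1 := by rw [hδ]; field_simp
  have hδ0 : 0 < δ := by rw [hδ]; positivity
  have hc0 : 0 < β / α := div_pos hβ hα
  have hc1 : 0 < 1 - β / α := sub_pos.2 ((div_lt_one hα).2 hβα)
  have hexp : Real.exp (-α) < 1 := by simpa using hα
  have hr0 : 0 < r := by rw [hr]; positivity
  have hr1 : r < 1 := by rw [hr]; nlinarith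
  have hq0 : 0 ≤ 1 - α * δ := by linarith
  have hq1 : 1 - α * δ ≤ 1 := by linarith [mul_pos hα hδ0]
  have hblock (k j : ℕ) (hj : j ≤ m) :
      Z (k * m + j) ≤ (β / α + (1 - β / α) * (1 - α * δ) ^ j) * Z (k * m) := by
    refine le_convex_combination_pow_of_affine_rec (a := fun i => Z (k * m + i)) hq0
      (fun l hl => (hrec k l hl).trans_eq ?_) hj
    simp only [add_zero]
    field_simp
    ring
  have hqm : (1 - α * δ) ^ m ≤ Real.exp (-α) := by
    calc (1 - α * δ) ^ m ≤ Real.exp (-(α * δ)) ^ m :=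
          pow_le_pow_left₀ hq0 (Real.one_sub_le_exp_neg _) m
      _ = Real.exp (-α) := by
        rw [← Real.exp_nat_mul]
        congr 1
        linear_combination (-α) * hδm
  have hstep (k : ℕ) : Z ((k + 1) * m) ≤ r * Z (k * m) := by
    rw [add_one_mul]
    refine (hblock k m le_rfl).trans (mul_le_mul_of_nonneg_right ?_ (hZ _))
    rw [hr]
    gcongr
  have hpow (k : ℕ) : Z (k * m) ≤ r ^ k * Z 0 := by
    induction k with
    | zero => simp
    | succ k ih =>
      calc Z ((k + 1) * m) ≤ r * Z (k * m) := hstep k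
        _ ≤ r * (r ^ k * Z 0) := by gcongr
        _ = r ^ (k + 1) * Z 0 := by ring
  have hexpk (k : ℕ) : Real.exp (k * Real.log r) = r ^ k := by
    rw [Real.exp_nat_mul, Real.exp_log hr0]
  refine ⟨⟨hr0, hr1⟩, fun k l hl => ?_, fun k => ?_⟩
  · have htime : ((k * m + l + 1 : ℕ) : ℝ) * δ ≤ ((k + 1 : ℕ) : ℝ) := by
      have hle : ((k * m + l + 1 : ℕ) : ℝ) ≤ ((k + 1) * m : ℕ) := by
        exact_mod_cast (by rw [add_one_mul]; omega : k * m + l + 1 ≤ (k + 1) * m)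
      calc ((k * m + l + 1 : ℕ) : ℝ) * δ ≤ ((k + 1) * m : ℕ) * δ := by gcongr
        _ = ((k + 1 : ℕ) : ℝ) := by
          push_cast
          linear_combination ((k : ℝ) + 1) * hδm
    calc Z (k * m + l + 1)
        ≤ (β / α + (1 - β / α) * (1 - α * δ) ^ (l + 1)) * Z (k * m) := hblock k (l + 1) hl
      _ ≤ 1 * Z (k * m) := by
        refine mul_le_mul_of_nonneg_right ?_ (hZ _)
        nlinarith [pow_le_one₀ hq0 hq1 (n := l + 1)]
      _ ≤ r ^ k * Z 0 := by simpa using hpow k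
      _ = (1 / r) * Real.exp (((k + 1 : ℕ) : ℝ) * Real.log r) * Z 0 := by
        rw [hexpk, pow_succ]
        field_simp
      _ ≤ (1 / r) * Real.exp (((k * m + l + 1 : ℕ) : ℝ) * δ * Real.log r) * Z 0 := by
        refine mul_le_mul_of_nonneg_right (mul_le_mul_of_nonneg_left ?_ (by positivity)) (hZ 0)
        exact Real.exp_le_exp.2 (mul_le_mul_of_nonpos_right htime (Real.log_neg hr0 hr1).le)
  · rw [hexpk]
    refine (hpow k).trans (mul_le_mul_of_nonneg_right ?_ (hZ 0))
    exact le_mul_of_one_le_left (by positivity) ((one_le_div hr0).2 hr1.le)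
end
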